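/- arXiv:math/0209323 — 2 statements merged into one kernel-verified Lean document; each statement's English description precedes it below -/
import Mathlib

section
/- (Abstract form of Theorem 2.1) Let H be a real inner product space, t₀ ∈ ℝ, T ∈ (t₀, ∞], and W : [t₀, T) → H a twice continuously differentiable curve with W(t) ≠ 0 for all t. Set ϖ(t) = ‖W(t)‖² and v(t) = ⟨W(t), W'(t)⟩ / ϖ(t)². Assume there is a constant c > 0 such that ⟨W(t), W''(t)⟩ ≥ (3 + c) · ‖W'(t)‖² for all t ∈ [t₀, T), and assume v(t₀) = v₀ > 0. Set ϖ₀ = ϖ(t₀) and T₀ = t₀ + 1/(c ϖ₀ v₀). Then for every t ∈ [t₀, T) with t < T₀, one has ‖W'(t)‖ ≥ (ϖ₀^{1/2}/c) / (T₀ − t). -/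
open scoped RealInnerProductSpace

/-- A real function on a closed interval with nonnegative derivative is monotone. -/
theorem monotoneOn_Icc_of_hasDerivWithinAt_nonneg {f f' : ℝ → ℝ} {a b : ℝ}
    (hf : ∀ x ∈ Set.Icc a b, HasDerivWithinAt f (f' x) (Set.Icc a b) x)
    (hf' : ∀ x ∈ Set.Icc a b, 0 ≤ f' x) : MonotoneOn f (Set.Icc a b) :=
  monotoneOn_of_hasDerivWithinAt_nonneg (convex_Icc a b)
    (fun x hx => (hf x hx).continuousWithinAt)
    (fun x hx => (hf x (interior_subset hx)).mono interior_subset)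
    (fun x hx => hf' x (interior_subset hx))

/-- A positive solution of the Riccati inequality `v' ≥ k v²` satisfies
`1 / v(b) ≤ 1 / v(a) - k (b - a)`. -/
theorem inv_le_of_riccati {v v' : ℝ → ℝ} {a b k : ℝ} (hab : a ≤ b)
    (hv : ∀ x ∈ Set.Icc a b, HasDerivWithinAt v (v' x) (Set.Icc a b) x)
    (hpos : ∀ x ∈ Set.Icc a b, 0 < v x)
    (hv' : ∀ x ∈ Set.Icc a b, k * v x ^ 2 ≤ v' x) :
    (v b)⁻¹ ≤ (v a)⁻¹ - k * (b - a) := by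
  have hmono : MonotoneOn (fun s => -(v s)⁻¹ - k * s) (Set.Icc a b) := by
    refine monotoneOn_Icc_of_hasDerivWithinAt_nonneg
      (f' := fun s => -(-v' s / v s ^ 2) - k * 1) (fun x hx => ?_) (fun x hx => ?_)
    · exact ((hv x hx).inv (hpos x hx).ne').neg.sub ((hasDerivWithinAt_id x _).const_mul k)
    · have h : k ≤ v' x / v x ^ 2 := (le_div_iff₀ (pow_pos (hpos x hx) 2)).2 (hv' x hx)
      rw [neg_div, neg_neg]
      linarith
  have h := hmono (Set.left_mem_Icc.2 hab) (Set.right_mem_Icc.2 hab) hab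
  simp only at h
  linarith

/-- The differential inequality for `⟪W, W'⟫ / ‖W‖⁴`, in pointwise form. -/
theorem riccati_quotient_bound {H : Type*} [NormedAddCommGroup H] [InnerProductSpace ℝ H]
    {w w' w'' : H} {c : ℝ} (hc : 0 ≤ c) (hw : w ≠ 0)
    (h : (3 + c) * ‖w'‖ ^ 2 ≤ ⟪w, w''⟫) :
    c * ‖w‖ ^ 2 * (⟪w, w'⟫ / (‖w‖ ^ 2) ^ 2) ^ 2 ≤
      ((⟪w, w''⟫ + ⟪w', w'⟫) * (‖w‖ ^ 2) ^ 2 -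
        ⟪w, w'⟫ * (2 * ‖w‖ ^ 2 * (2 * ⟪w, w'⟫))) / ((‖w‖ ^ 2) ^ 2) ^ 2 := by
  have hn : 0 < ‖w‖ ^ 2 := pow_pos (norm_pos_iff.2 hw) 2
  have hcs : ⟪w, w'⟫ ^ 2 ≤ ‖w‖ ^ 2 * ‖w'‖ ^ 2 := by
    rw [← mul_pow, ← sq_abs]
    exact pow_le_pow_left₀ (abs_nonneg _) (abs_real_inner_le_norm w w') 2
  rw [real_inner_self_eq_norm_sq]
  generalize ⟪w, w'⟫ = a at *
  generalize ⟪w, w''⟫ = d at *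
  generalize ‖w‖ ^ 2 = n at *
  generalize ‖w'‖ ^ 2 = m at *
  rw [div_pow, ← mul_div_assoc]
  refine div_le_div_of_nonneg_right ?_ (by positivity)
  have h1 : (4 + c) * a ^ 2 ≤ (4 + c) * (n * m) :=
    mul_le_mul_of_nonneg_left hcs (by linarith)
  have h2 : n * ((3 + c) * m) ≤ n * d := mul_le_mul_of_nonneg_left h hn.le
  have h3 : 0 ≤ n * (n * (d + m) - (4 + c) * a ^ 2) :=
    mul_nonneg hn.le (by linarith)
  linarith

/-- Abstract form of Theorem 2.1: if `⟨W, W''⟩ ≥ (3 + c) ‖W'‖²` on `[t₀, T)` and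
`v(t₀) = v₀ > 0`, then `‖W'(t)‖ ≥ (ϖ₀^{1/2}/c)/(T₀ − t)` for `t < T₀ = t₀ + 1/(c ϖ₀ v₀)`. -/
theorem stmt5 {H : Type*} [NormedAddCommGroup H] [InnerProductSpace ℝ H]
    (t₀ : ℝ) (T : EReal) (hT : (t₀ : EReal) < T)
    (W W' W'' : ℝ → H)
    (hWne : ∀ t : ℝ, t₀ ≤ t → (t : EReal) < T → W t ≠ 0)
    (hW : ∀ t : ℝ, t₀ ≤ t → (t : EReal) < T →
      HasDerivWithinAt W (W' t) {s : ℝ | t₀ ≤ s ∧ (s : EReal) < T} t)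
    (hW' : ∀ t : ℝ, t₀ ≤ t → (t : EReal) < T →
      HasDerivWithinAt W' (W'' t) {s : ℝ | t₀ ≤ s ∧ (s : EReal) < T} t)
    (hW''cont : ContinuousOn W'' {s : ℝ | t₀ ≤ s ∧ (s : EReal) < T})
    (c v₀ : ℝ) (hc : 0 < c) (hv₀ : 0 < v₀)
    (hineq : ∀ t : ℝ, t₀ ≤ t → (t : EReal) < T →
      ⟪W t, W'' t⟫ ≥ (3 + c) * ‖W' t‖ ^ 2)
    (hv0 : ⟪W t₀, W' t₀⟫ / (‖W t₀‖ ^ 2) ^ 2 = v₀) :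
    ∀ t : ℝ, t₀ ≤ t → (t : EReal) < T →
      t < t₀ + 1 / (c * ‖W t₀‖ ^ 2 * v₀) →
      ‖W' t‖ ≥ (Real.sqrt (‖W t₀‖ ^ 2) / c) /
        ((t₀ + 1 / (c * ‖W t₀‖ ^ 2 * v₀)) - t) := by
  intro t ht htT htT₀
  have hsub : Set.Icc t₀ t ⊆ {s : ℝ | t₀ ≤ s ∧ (s : EReal) < T} := fun s hs =>
    ⟨hs.1, (EReal.coe_le_coe_iff.2 hs.2).trans_lt htT⟩
  have hd : ∀ s ∈ Set.Icc t₀ t, HasDerivWithinAt W (W' s) (Set.Icc t₀ t) s := fun s hs =>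
    (hW s (hsub hs).1 (hsub hs).2).mono hsub
  have hd' : ∀ s ∈ Set.Icc t₀ t, HasDerivWithinAt W' (W'' s) (Set.Icc t₀ t) s := fun s hs =>
    (hW' s (hsub hs).1 (hsub hs).2).mono hsub
  have hne : ∀ s ∈ Set.Icc t₀ t, W s ≠ 0 := fun s hs => hWne s (hsub hs).1 (hsub hs).2
  have hnpos : ∀ s ∈ Set.Icc t₀ t, 0 < ‖W s‖ ^ 2 := fun s hs =>
    pow_pos (norm_pos_iff.2 (hne s hs)) 2
  have h₀ : t₀ ∈ Set.Icc t₀ t := Set.left_mem_Icc.2 ht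
  have h₁ : t ∈ Set.Icc t₀ t := Set.right_mem_Icc.2 ht
  have hn : ∀ s ∈ Set.Icc t₀ t,
      HasDerivWithinAt (fun s => ‖W s‖ ^ 2) (2 * ⟪W s, W' s⟫) (Set.Icc t₀ t) s :=
    fun s hs => (hd s hs).norm_sq
  have hv : ∀ s ∈ Set.Icc t₀ t,
      HasDerivWithinAt (fun s => ⟪W s, W' s⟫ / (‖W s‖ ^ 2) ^ 2)
        (((⟪W s, W'' s⟫ + ⟪W' s, W' s⟫) * (‖W s‖ ^ 2) ^ 2 -
          ⟪W s, W' s⟫ * (2 * ‖W s‖ ^ 2 * (2 * ⟪W s, W' s⟫))) / ((‖W s‖ ^ 2) ^ 2) ^ 2)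
        (Set.Icc t₀ t) s := by
    intro s hs
    have h2 := (hn s hs).pow 2
    simp only [Nat.cast_ofNat, Nat.add_one_sub_one, pow_one] at h2
    exact ((hd s hs).inner ℝ (hd' s hs)).div h2 (pow_pos (hnpos s hs) 2).ne'
  have hbound := fun s (hs : s ∈ Set.Icc t₀ t) =>
    riccati_quotient_bound hc.le (hne s hs) (hineq s (hsub hs).1 (hsub hs).2)
  have hvmono := monotoneOn_Icc_of_hasDerivWithinAt_nonneg hv fun s hs =>
    le_trans (by positivity) (hbound s hs)
  have hvpos : ∀ s ∈ Set.Icc t₀ t, 0 < ⟪W s, W' s⟫ / (‖W s‖ ^ 2) ^ 2 := fun s hs =>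
    (hv₀.trans_eq hv0.symm).trans_le (hvmono h₀ hs hs.1)
  have hnmono := monotoneOn_Icc_of_hasDerivWithinAt_nonneg hn fun s hs => by
    have := (div_pos_iff_of_pos_right (pow_pos (hnpos s hs) 2)).1 (hvpos s hs)
    positivity
  have hinv := inv_le_of_riccati (k := c * ‖W t₀‖ ^ 2) ht hv hvpos fun s hs =>
    le_trans (mul_le_mul_of_nonneg_right
      (mul_le_mul_of_nonneg_left (hnmono h₀ hs hs.1) hc.le) (sq_nonneg _)) (hbound s hs)
  simp only [hv0] at hinv
  have hN : ‖W t₀‖ ≤ ‖W t‖ :=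
    le_of_sq_le_sq (hnmono h₀ h₁ ht) (norm_nonneg _)
  have hcs := real_inner_le_norm (W t) (W' t)
  have hN₀ : 0 < ‖W t₀‖ := norm_pos_iff.2 (hne t₀ h₀)
  have hNt : 0 < ‖W t‖ := norm_pos_iff.2 (hne t h₁)
  have hvt := hvpos t h₁
  have hva : ⟪W t, W' t⟫ = ⟪W t, W' t⟫ / (‖W t‖ ^ 2) ^ 2 * (‖W t‖ ^ 2) ^ 2 :=
    (div_mul_cancel₀ _ (pow_pos (hnpos t h₁) 2).ne').symm
  generalize ⟪W t, W' t⟫ / (‖W t‖ ^ 2) ^ 2 = v at *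
  have hgap : v₀⁻¹ - c * ‖W t₀‖ ^ 2 * (t - t₀) =
      c * ‖W t₀‖ ^ 2 * (t₀ + 1 / (c * ‖W t₀‖ ^ 2 * v₀) - t) := by
    field_simp
    ring
  have hτ : 0 < t₀ + 1 / (c * ‖W t₀‖ ^ 2 * v₀) - t := sub_pos.2 htT₀
  rw [hgap] at hinv
  generalize t₀ + 1 / (c * ‖W t₀‖ ^ 2 * v₀) - t = τ at *
  have hone : 1 ≤ c * ‖W t₀‖ ^ 2 * τ * v := (inv_le_iff_one_le_mul₀ hvt).1 hinv
  have hlow : v * ‖W t‖ ^ 3 ≤ ‖W' t‖ := by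
    refine le_of_mul_le_mul_left ?_ hNt
    linarith
  have hcube : v * ‖W t₀‖ ^ 3 ≤ v * ‖W t‖ ^ 3 := by gcongr
  rw [Real.sqrt_sq hN₀.le, ge_iff_le, div_div, div_le_iff₀ (mul_pos hc hτ)]
  calc ‖W t₀‖ ≤ ‖W t₀‖ * (c * ‖W t₀‖ ^ 2 * τ * v) := le_mul_of_one_le_right hN₀.le hone
    _ = v * ‖W t₀‖ ^ 3 * (c * τ) := by ring
    _ ≤ ‖W' t‖ * (c * τ) :=
      mul_le_mul_of_nonneg_right (hcube.trans hlow) (mul_pos hc hτ).le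
end

section
/- (Theorem 2.1, L² form) Let (Ω, m) be a measure space, t₀ ∈ ℝ, T ∈ (t₀, ∞], and ω : [t₀, T) × Ω → ℝ³ measurable in x and, for m-a.e. x, twice differentiable in t. Let λ, μ_m : [t₀, T) × Ω → ℝ and c > 0 be such that for all t and m-a.e. x: ∂_t²ω(t,x) = λ(t,x) · ω(t,x), |∂_tω(t,x)| ≤ μ_m(t,x) · |ω(t,x)|, and λ(t,x) ≥ (3 + c) · μ_m(t,x)². Assume ϖ(t) = ∫_Ω |ω(t,x)|² dm is finite and nonzero for all t, that ∂_tω(t,·) is square-integrable, that ϖ is differentiable with ϖ'(t) = 2∫_Ω ⟨ω, ∂_tω⟩ dm, and that g(t) = ∫_Ω ⟨ω, ∂_tω⟩ dm is differentiable with g'(t) = ∫_Ω (|∂_tω|² + ⟨ω, ∂_t²ω⟩) dm. Define v(t) = g(t)/ϖ(t)² and assume v₀ = v(t₀) > 0. Set ϖ₀ = ϖ(t₀) and T₀ = t₀ + 1/(c ϖ₀ v₀). Then for every t ∈ [t₀, T) with t < T₀: ‖∂_tω(t,·)‖_{L²(Ω)} ≥ (ϖ₀^{1/2}/c)/(T₀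 − t); in particular T ≤ T₀, and if T = T₀ then limsup_{t↑T₀} ‖∂_tω(t,·)‖_{L²(Ω)} = ∞. -/
open scoped RealInnerProductSpace
open MeasureTheory

open Set Filter Topology in
/-- A function differentiable everywhere on a closed interval, whose derivative is nonnegative
almost everywhere, takes a larger value at the right endpoint than at the left one. -/
lemma le_of_hasDerivWithinAt_of_ae_nonneg {f f' : ℝ → ℝ} {a b : ℝ} (hab : a ≤ b)
    (hf : ∀ t ∈ Icc a b, HasDerivWithinAt f (f' t) (Icc a b) t)
    (hf' : ∀ᵐ t ∂volume.restrict (Ioo a b), 0 ≤ f' t) : f a ≤ f b := by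
  have h0 : (Ioo a b).indicator (fun t => max (-f' t) 0) =ᵐ[volume] 0 := by
    rw [ae_restrict_iff' measurableSet_Ioo] at hf'
    filter_upwards [hf'] with t ht
    by_cases h : t ∈ Ioo a b
    · simp [h, ht h]
    · simp [h]
  have key := intervalIntegral.sub_le_integral_of_hasDeriv_right_of_le
    (g := fun t => -f t) (g' := fun t => -f' t)
    (φ := (Ioo a b).indicator (fun t => max (-f' t) 0)) hab
    (fun t ht => (hf t ht).continuousWithinAt.neg)
    (fun t ht => (((hf t (Ioo_subset_Icc_self ht)).hasDerivAt
      (Icc_mem_nhds ht.1 ht.2)).hasDerivWithinAt).neg)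
    (((integrable_zero ℝ ℝ volume).congr h0.symm).integrableOn)
    (fun t ht => by rw [indicator_of_mem ht]; exact le_max_left _ _)
  have h1 : ∫ t in a..b, (Ioo a b).indicator (fun t => max (-f' t) 0) t = 0 := by
    rw [intervalIntegral.integral_congr_ae (g := fun _ => (0 : ℝ))]
    · simp
    · filter_upwards [h0] with t ht _ using ht
  linarith

open Set Filter Topology in
/-- Auxiliary form of `ae_le_of_hasDerivWithinAt_of_ae_nonneg` for complete measures. -/
lemma ae_le_of_hasDerivWithinAt_of_ae_nonneg_of_isComplete {Ω : Type*} [MeasurableSpace Ω]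
    {m : Measure Ω} [m.IsComplete] [SigmaFinite m] {h h' : ℝ → Ω → ℝ} {a b : ℝ} (hab : a ≤ b)
    (hm : ∀ t ∈ Icc a b, Measurable (h t))
    (hd : ∀ᵐ x ∂m, ∀ t ∈ Icc a b,
      HasDerivWithinAt (fun s => h s x) (h' t x) (Icc a b) t)
    (hn : ∀ t ∈ Icc a b, ∀ᵐ x ∂m, 0 ≤ h' t x) :
    ∀ᵐ x ∂m, h a x ≤ h b x := by
  set G : Set Ω := {x | ∀ t ∈ Icc a b, HasDerivWithinAt (fun s => h s x) (h' t x) (Icc a b) t}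
  let u : ℝ → Ω → ℝ := fun t => G.indicator (h (projIcc a b hab t))
  have hu_meas : ∀ t, Measurable (u t) := fun t => by
    refine (hm _ (projIcc a b hab t).2).congr_ae (μ := m) ?_
    filter_upwards [hd] with x hx
    exact (indicator_of_mem (show x ∈ G from hx) _).symm
  have hu_cont : ∀ x, Continuous fun t => u t x := fun x => by
    by_cases hx : x ∈ G
    · have : ContinuousOn (fun s => h s x) (Icc a b) :=
        fun t ht => (hx t ht).continuousWithinAt
      have h2 := this.domRestrict.comp (continuous_projIcc (h := hab))
      simpa [u, hx, Function.comp_def] using h2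
    · simpa [u, hx] using continuous_const
  have hu := measurable_uncurry_of_continuous_of_measurable hu_cont hu_meas
  let D : ℝ → Ω → EReal := fun t x => liminf (fun n : ℕ =>
    (((n + 1 : ℝ) * (u (t + 1 / (n + 1)) x - u t x) : ℝ) : EReal)) atTop
  have hD_meas : Measurable (fun p : ℝ × Ω => D p.1 p.2) := by
    refine Measurable.liminf fun n => Measurable.coe_real_ereal ?_
    have h1 : Measurable fun p : ℝ × Ω => u (p.1 + 1 / (n + 1)) p.2 :=
      hu.comp ((measurable_fst.add_const _).prodMk measurable_snd)
    exact (h1.sub hu).const_mul _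
  have hD : ∀ x ∈ G, ∀ t ∈ Ioo a b, D t x = (h' t x : EReal) := by
    intro x hx t ht
    have hder : HasDerivAt (fun s => u s x) (h' t x) t := by
      refine ((hx t (Ioo_subset_Icc_self ht)).hasDerivAt
        (Icc_mem_nhds ht.1 ht.2)).congr_of_eventuallyEq ?_
      filter_upwards [Icc_mem_nhds ht.1 ht.2] with s hs
      simp [u, hx, projIcc_of_mem hab hs]
    have hseq : Tendsto (fun n : ℕ => (1 : ℝ) / (n + 1)) atTop (𝓝[≠] 0) := by
      refine tendsto_nhdsWithin_iff.2 ⟨tendsto_one_div_add_atTop_nhds_zero_nat, ?_⟩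
      exact Eventually.of_forall fun n => by
        simp only [mem_compl_iff, mem_singleton_iff]; positivity
    have hlim := hder.tendsto_slope_zero.comp hseq
    refine Tendsto.liminf_eq ?_
    refine (continuous_coe_real_ereal.tendsto _).comp (hlim.congr fun n => ?_)
    simp
  have hp : MeasurableSet {p : ℝ × Ω | 0 ≤ D p.1 p.2} := measurableSet_le measurable_const hD_meas
  have h1 : ∀ᵐ t ∂volume.restrict (Ioo a b), ∀ᵐ x ∂m, 0 ≤ D t x := by
    refine (ae_restrict_iff' measurableSet_Ioo).2 (Eventually.of_forall fun t ht => ?_)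
    filter_upwards [hd, hn t (Ioo_subset_Icc_self ht)] with x hx hx'
    rw [hD x hx t ht]
    exact_mod_cast hx'
  have h2 := (Measure.ae_ae_comm (p := fun t x => 0 ≤ D t x) hp).1 h1
  filter_upwards [hd, h2] with x hx hx2
  refine le_of_hasDerivWithinAt_of_ae_nonneg hab hx ?_
  filter_upwards [hx2, ae_restrict_mem measurableSet_Ioo] with t ht ht'
  rw [hD x hx t ht'] at ht
  exact_mod_cast ht

open Set Filter Topology in
/-- If `t ↦ h t x` is differentiable for almost every `x`, with derivative at each time `t`
nonnegative outside a null set that may depend on `t`, then `h a ≤ h b` almost everywhere. -/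
lemma ae_le_of_hasDerivWithinAt_of_ae_nonneg {Ω : Type*} [MeasurableSpace Ω]
    {m : Measure Ω} [SigmaFinite m] {h h' : ℝ → Ω → ℝ} {a b : ℝ} (hab : a ≤ b)
    (hm : ∀ t ∈ Icc a b, AEMeasurable (h t) m)
    (hd : ∀ᵐ x ∂m, ∀ t ∈ Icc a b,
      HasDerivWithinAt (fun s => h s x) (h' t x) (Icc a b) t)
    (hn : ∀ t ∈ Icc a b, ∀ᵐ x ∂m, 0 ≤ h' t x) :
    ∀ᵐ x ∂m, h a x ≤ h b x := by
  have hfin := measure_spanningSets_lt_top m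
  have hspan := iUnion_spanningSets m
  have : SigmaFinite m.completion := ⟨⟨⟨_, fun _ => trivial, hfin, hspan⟩⟩⟩
  exact ae_le_of_hasDerivWithinAt_of_ae_nonneg_of_isComplete (m := m.completion) hab
    (fun t ht => (hm t ht).nullMeasurable.measurable') hd hn

open Set Filter Topology in
/-- Version of `ae_le_of_hasDerivWithinAt_of_ae_nonneg` for integrable functions on an arbitrary
measure space. -/
lemma ae_le_of_hasDerivWithinAt_of_ae_nonneg_of_integrable {Ω : Type*} [MeasurableSpace Ω]
    {m : Measure Ω} {h h' : ℝ → Ω → ℝ} {a b : ℝ} (hab : a ≤ b)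
    (hi : ∀ t ∈ Icc a b, Integrable (h t) m)
    (hd : ∀ᵐ x ∂m, ∀ t ∈ Icc a b,
      HasDerivWithinAt (fun s => h s x) (h' t x) (Icc a b) t)
    (hn : ∀ t ∈ Icc a b, ∀ᵐ x ∂m, 0 ≤ h' t x) :
    ∀ᵐ x ∂m, h a x ≤ h b x := by
  have hF := ((hi a (left_mem_Icc.2 hab)).norm.add
    (hi b (right_mem_Icc.2 hab)).norm).aefinStronglyMeasurable
  refine ae_of_ae_restrict_of_ae_restrict_compl hF.sigmaFiniteSet ?_ ?_
  · exact ae_le_of_hasDerivWithinAt_of_ae_nonneg hab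
      (fun t ht => (hi t ht).aemeasurable.restrict) (ae_restrict_of_ae hd)
      (fun t ht => ae_restrict_of_ae (hn t ht))
  · filter_upwards [hF.ae_eq_zero_compl] with x hx
    simp only [Pi.add_apply, Pi.zero_apply, Real.norm_eq_abs] at hx
    have ha := abs_nonneg (h a x)
    have hb := abs_nonneg (h b x)
    rw [abs_eq_zero.1 (by linarith : |h a x| = 0), abs_eq_zero.1 (by linarith : |h b x| = 0)]

open Set Filter Topology in
/-- If the pointwise time derivative is nonnegative and the integral is differentiable at `a`,
then the pointwise derivative at `a` is integrable. -/
lemma integrable_deriv_of_differentiableWithinAt_integral {Ω : Type*} [MeasurableSpace Ω]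
    {m : Measure Ω} {h h' : ℝ → Ω → ℝ} {a b : ℝ} (hab : a < b)
    (hi : ∀ t ∈ Icc a b, Integrable (h t) m)
    (hd : ∀ᵐ x ∂m, ∀ t ∈ Icc a b,
      HasDerivWithinAt (fun s => h s x) (h' t x) (Icc a b) t)
    (hn : ∀ t ∈ Icc a b, ∀ᵐ x ∂m, 0 ≤ h' t x)
    (hD : DifferentiableWithinAt ℝ (fun t => ∫ x, h t x ∂m) (Icc a b) a) :
    Integrable (h' a) m := by
  have ha : a ∈ Icc a b := left_mem_Icc.2 hab.le
  let s : ℕ → ℝ := fun n => a + (b - a) * (1 / ((n : ℝ) + 1))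
  have hsa : ∀ n, a < s n := fun n => by
    have := mul_pos (sub_pos.2 hab) (Nat.one_div_pos_of_nat (α := ℝ) (n := n))
    simp only [s]; linarith
  have hsb : ∀ n, s n ≤ b := fun n => by
    have h1 : 1 / ((n : ℝ) + 1) ≤ 1 := by
      rw [div_le_one (by positivity)]; linarith [Nat.cast_nonneg (α := ℝ) n]
    have := mul_le_mul_of_nonneg_left h1 (sub_pos.2 hab).le
    simp only [s]; linarith
  have hsI : ∀ n, s n ∈ Icc a b := fun n => ⟨(hsa n).le, hsb n⟩
  have hslim : Tendsto s atTop (𝓝[Icc a b \ {a}] a) := by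
    refine tendsto_nhdsWithin_iff.2 ⟨?_, Eventually.of_forall fun n => ⟨hsI n, (hsa n).ne'⟩⟩
    have := (tendsto_one_div_add_atTop_nhds_zero_nat (𝕜 := ℝ)).const_mul (b - a)
    simpa [s] using this.const_add a
  let q : ℕ → Ω → ℝ := fun n x => (s n - a)⁻¹ * (h (s n) x - h a x)
  have hqi : ∀ n, Integrable (q n) m := fun n => ((hi _ (hsI n)).sub (hi a ha)).const_mul _
  have hqn : ∀ n, 0 ≤ᵐ[m] q n := fun n => by
    have hsub : Icc a (s n) ⊆ Icc a b := Icc_subset_Icc le_rfl (hsb n)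
    have := ae_le_of_hasDerivWithinAt_of_ae_nonneg_of_integrable (m := m) (h := h) (h' := h')
      (hsa n).le (fun t ht => hi t (hsub ht))
      (by filter_upwards [hd] with x hx t ht using (hx t (hsub ht)).mono hsub)
      (fun t ht => hn t (hsub ht))
    filter_upwards [this] with x hx
    exact mul_nonneg (inv_nonneg.2 (sub_nonneg.2 (hsa n).le)) (sub_nonneg.2 hx)
  have hqlim : ∀ᵐ x ∂m, Tendsto (fun n => q n x) atTop (𝓝 (h' a x)) := by
    filter_upwards [hd] with x hx
    exact (hasDerivWithinAt_iff_tendsto_slope.1 (hx a ha)).comp hslim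
  have hIlim := (hasDerivWithinAt_iff_tendsto_slope.1 hD.hasDerivWithinAt).comp hslim
  have hIq : ∀ n, ∫ x, q n x ∂m = slope (fun t => ∫ x, h t x ∂m) a (s n) := fun n => by
    simp only [q]
    rw [integral_const_mul, integral_sub (hi _ (hsI n)) (hi a ha)]
    rfl
  have hmeas : AEStronglyMeasurable (h' a) m :=
    aestronglyMeasurable_of_tendsto_ae atTop (fun n => (hqi n).aestronglyMeasurable) hqlim
  refine (lintegral_ofReal_ne_top_iff_integrable hmeas (hn a ha)).1 (ne_of_lt ?_)
  calc ∫⁻ x, ENNReal.ofReal (h' a x) ∂m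
      = ∫⁻ x, liminf (fun n => ENNReal.ofReal (q n x)) atTop ∂m := by
        refine lintegral_congr_ae ?_
        filter_upwards [hqlim] with x hx
        exact (((ENNReal.continuous_ofReal.tendsto _).comp hx).liminf_eq).symm
    _ ≤ liminf (fun n => ∫⁻ x, ENNReal.ofReal (q n x) ∂m) atTop :=
        lintegral_liminf_le' fun n => (hqi n).aemeasurable.ennreal_ofReal
    _ = ENNReal.ofReal (derivWithin (fun t => ∫ x, h t x ∂m) (Icc a b) a) := by
        refine Tendsto.liminf_eq ?_
        refine ((ENNReal.continuous_ofReal.tendsto _).comp hIlim).congr fun n => ?_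
        rw [← ofReal_integral_eq_lintegral_ofReal (hqi n) (hqn n), hIq]
        rfl
    _ < ⊤ := ENNReal.ofReal_lt_top

/-- Cauchy–Schwarz for the `L²` pairing of square-integrable vector fields. -/
lemma sq_integral_inner_le {Ω E : Type*} [MeasurableSpace Ω] {m : Measure Ω}
    [NormedAddCommGroup E] [InnerProductSpace ℝ E] {f g : Ω → E}
    (hf : Integrable (fun x => ‖f x‖ ^ 2) m) (hg : Integrable (fun x => ‖g x‖ ^ 2) m)
    (hfg : Integrable (fun x => ⟪f x, g x⟫) m) :
    (∫ x, ⟪f x, g x⟫ ∂m) ^ 2 ≤ (∫ x, ‖f x‖ ^ 2 ∂m) * ∫ x, ‖g x‖ ^ 2 ∂m := by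
  have key : ∀ r : ℝ, 0 ≤ (∫ x, ‖f x‖ ^ 2 ∂m) * (r * r) +
      (-2 * ∫ x, ⟪f x, g x⟫ ∂m) * r + ∫ x, ‖g x‖ ^ 2 ∂m := by
    intro r
    have h0 : 0 ≤ ∫ x, ‖g x - r • f x‖ ^ 2 ∂m := integral_nonneg fun x => by positivity
    have h1 : ∀ x, ‖g x - r • f x‖ ^ 2 =
        (r * r) * ‖f x‖ ^ 2 + (-2 * r) * ⟪f x, g x⟫ + ‖g x‖ ^ 2 := fun x => by
      rw [norm_sub_sq_real, inner_smul_right, real_inner_comm, norm_smul, mul_pow,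
        Real.norm_eq_abs, sq_abs]
      ring
    simp only [h1] at h0
    rw [integral_add (by exact (hf.const_mul _).add (hfg.const_mul _)) hg,
      integral_add (hf.const_mul _) (hfg.const_mul _), integral_const_mul,
      integral_const_mul] at h0
    linarith
  have := discrim_le_zero key
  rw [discrim] at this
  linarith

/-- The pairing of square-integrable vector fields is integrable. -/
lemma integrable_inner_of_sq {Ω E : Type*} [MeasurableSpace Ω] {m : Measure Ω}
    [NormedAddCommGroup E] [InnerProductSpace ℝ E] {f g : Ω → E}
    (hfm : AEStronglyMeasurable f m) (hgm : AEStronglyMeasurable g m)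
    (hf : Integrable (fun x => ‖f x‖ ^ 2) m) (hg : Integrable (fun x => ‖g x‖ ^ 2) m) :
    Integrable (fun x => ⟪f x, g x⟫) m := by
  refine (hf.add hg).mono' (hfm.inner hgm) (Filter.Eventually.of_forall fun x => ?_)
  have h1 := norm_inner_le_norm (𝕜 := ℝ) (f x) (g x)
  simp only [Pi.add_apply]
  nlinarith [sq_nonneg (‖f x‖ - ‖g x‖), norm_nonneg (f x), norm_nonneg (g x)]

/-- The scalar comparison argument: if `w' = 2g` and `g' ≥ (4 + c) g² / w`, then `w² / g`
decreases at least linearly. -/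
lemma sq_div_le_of_hasDerivWithinAt {I : Set ℝ} (hI : Convex ℝ I) {w g g' : ℝ → ℝ} {c t₀ : ℝ}
    (hc : 0 < c) (ht₀ : t₀ ∈ I) (hmin : ∀ t ∈ I, t₀ ≤ t) (hw : ∀ t ∈ I, 0 < w t)
    (hw' : ∀ t ∈ I, HasDerivWithinAt w (2 * g t) I t)
    (hg' : ∀ t ∈ I, HasDerivWithinAt g (g' t) I t)
    (hgg : ∀ t ∈ I, (4 + c) * g t ^ 2 ≤ w t * g' t) (hg0 : 0 < g t₀) :
    ∀ t ∈ I, 0 < g t ∧ w t₀ ≤ w t ∧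
      w t ^ 2 / g t ≤ w t₀ ^ 2 / g t₀ - c * w t₀ * (t - t₀) := by
  have hsub : interior I ⊆ I := interior_subset
  have hgmono : MonotoneOn g I := monotoneOn_of_hasDerivWithinAt_nonneg hI
    (fun t ht => (hg' t ht).continuousWithinAt) (fun t ht => (hg' t (hsub ht)).mono hsub)
    (fun t ht => by
      have h1 := hgg t (hsub ht)
      have h2 : 0 ≤ (4 + c) * g t ^ 2 := by positivity
      exact nonneg_of_mul_nonneg_right (h2.trans h1) (hw t (hsub ht)))
  have hgpos : ∀ t ∈ I, 0 < g t := fun t ht => hg0.trans_le (hgmono ht₀ ht (hmin t ht))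
  have hwmono : MonotoneOn w I := monotoneOn_of_hasDerivWithinAt_nonneg hI
    (fun t ht => (hw' t ht).continuousWithinAt) (fun t ht => (hw' t (hsub ht)).mono hsub)
    (fun t ht => by linarith [hgpos t (hsub ht)])
  have hder : ∀ t ∈ I, HasDerivWithinAt (fun t => w t ^ 2 / g t + c * w t₀ * (t - t₀))
      ((2 * w t * (2 * g t) * g t - w t ^ 2 * g' t) / g t ^ 2 + c * w t₀) I t := by
    intro t ht
    have h1 := (((hw' t ht).pow 2).div (hg' t ht) (hgpos t ht).ne').add
      (((hasDerivWithinAt_id t I).sub_const t₀).const_mul (c * w t₀))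
    refine HasDerivWithinAt.congr_deriv h1 ?_
    simp
  have hanti := antitoneOn_of_hasDerivWithinAt_nonpos hI
    (fun t ht => (hder t ht).continuousWithinAt)
    (fun t ht => (hder t (hsub ht)).mono hsub)
    (fun t ht => by
      have hg := hgpos t (hsub ht)
      have h1 : (2 * w t * (2 * g t) * g t - w t ^ 2 * g' t) / g t ^ 2 ≤ -(c * w t) := by
        rw [div_le_iff₀ (by positivity)]
        nlinarith [mul_le_mul_of_nonneg_left (hgg t (hsub ht)) (hw t (hsub ht)).le]
      have h2 := mul_le_mul_of_nonneg_left (hwmono ht₀ (hsub ht) (hmin t (hsub ht))) hc.le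
      linarith)
  intro t ht
  refine ⟨hgpos t ht, hwmono ht₀ ht (hmin t ht), ?_⟩
  have := hanti ht₀ ht (hmin t ht)
  simp only [sub_self, mul_zero, add_zero] at this
  linarith

/-- Theorem 2.1, L² form: under the alignment `∂_t²ω = λω`, the strain bound
`|∂_tω| ≤ μ_m|ω|` and `λ ≥ (3+c)μ_m²`, with `v₀ = v(t₀) > 0`, the L² norm of `∂_tω`
blows up no later than `T₀ = t₀ + 1/(c ϖ₀ v₀)`. -/
theorem stmt7 {Ω : Type*} [MeasurableSpace Ω] (m : Measure Ω)
    (t₀ : ℝ) (T : EReal) (hT : (t₀ : EReal) < T)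
    (ω ω' ω'' : ℝ → Ω → EuclideanSpace ℝ (Fin 3))
    (lam μm : ℝ → Ω → ℝ) (c : ℝ) (hc : 0 < c)
    (hmeas : ∀ t : ℝ, t₀ ≤ t → (t : EReal) < T →
      AEStronglyMeasurable (ω t) m ∧ AEStronglyMeasurable (ω' t) m)
    (hderiv : ∀ᵐ x ∂m, ∀ t : ℝ, t₀ ≤ t → (t : EReal) < T →
      HasDerivWithinAt (fun s => ω s x) (ω' t x) {s : ℝ | t₀ ≤ s ∧ (s : EReal) < T} t ∧
      HasDerivWithinAt (fun s => ω' s x) (ω'' t x) {s : ℝ | t₀ ≤ s ∧ (s : EReal) < T} t)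
    (halign : ∀ t : ℝ, t₀ ≤ t → (t : EReal) < T → ∀ᵐ x ∂m,
      ω'' t x = lam t x • ω t x ∧
      ‖ω' t x‖ ≤ μm t x * ‖ω t x‖ ∧
      lam t x ≥ (3 + c) * μm t x ^ 2)
    (hω2 : ∀ t : ℝ, t₀ ≤ t → (t : EReal) < T → Integrable (fun x => ‖ω t x‖ ^ 2) m)
    (hϖne : ∀ t : ℝ, t₀ ≤ t → (t : EReal) < T → (∫ x, ‖ω t x‖ ^ 2 ∂m) ≠ 0)
    (hω'2 : ∀ t : ℝ, t₀ ≤ t → (t : EReal) < T → Integrable (fun x => ‖ω' t x‖ ^ 2) m)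
    (hϖderiv : ∀ t : ℝ, t₀ ≤ t → (t : EReal) < T →
      HasDerivWithinAt (fun s => ∫ x, ‖ω s x‖ ^ 2 ∂m)
        (2 * ∫ x, ⟪ω t x, ω' t x⟫ ∂m) {s : ℝ | t₀ ≤ s ∧ (s : EReal) < T} t)
    (hgderiv : ∀ t : ℝ, t₀ ≤ t → (t : EReal) < T →
      HasDerivWithinAt (fun s => ∫ x, ⟪ω s x, ω' s x⟫ ∂m)
        (∫ x, (‖ω' t x‖ ^ 2 + ⟪ω t x, ω'' t x⟫) ∂m)
        {s : ℝ | t₀ ≤ s ∧ (s : EReal) < T} t)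
    (v₀ : ℝ) (hv₀ : 0 < v₀)
    (hv0 : (∫ x, ⟪ω t₀ x, ω' t₀ x⟫ ∂m) / (∫ x, ‖ω t₀ x‖ ^ 2 ∂m) ^ 2 = v₀) :
    (∀ t : ℝ, t₀ ≤ t → (t : EReal) < T →
      t < t₀ + 1 / (c * (∫ x, ‖ω t₀ x‖ ^ 2 ∂m) * v₀) →
      Real.sqrt (∫ x, ‖ω' t x‖ ^ 2 ∂m) ≥
        (Real.sqrt (∫ x, ‖ω t₀ x‖ ^ 2 ∂m) / c) /
          ((t₀ + 1 / (c * (∫ x, ‖ω t₀ x‖ ^ 2 ∂m) * v₀)) - t)) ∧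
    T ≤ ((t₀ + 1 / (c * (∫ x, ‖ω t₀ x‖ ^ 2 ∂m) * v₀) : ℝ) : EReal) ∧
    (T = ((t₀ + 1 / (c * (∫ x, ‖ω t₀ x‖ ^ 2 ∂m) * v₀) : ℝ) : EReal) →
      ∀ M : ℝ, ∃ᶠ t in nhdsWithin (t₀ + 1 / (c * (∫ x, ‖ω t₀ x‖ ^ 2 ∂m) * v₀))
        (Set.Iio (t₀ + 1 / (c * (∫ x, ‖ω t₀ x‖ ^ 2 ∂m) * v₀))),
        M ≤ Real.sqrt (∫ x, ‖ω' t x‖ ^ 2 ∂m)) := by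
  set I : Set ℝ := {s : ℝ | t₀ ≤ s ∧ (s : EReal) < T}
  have hI : Convex ℝ I := by
    refine Set.OrdConnected.convex ⟨fun x hx y hy z hz => ⟨hx.1.trans hz.1, ?_⟩⟩
    exact (EReal.coe_le_coe_iff.2 hz.2).trans_lt hy.2
  have ht₀ : t₀ ∈ I := ⟨le_rfl, hT⟩
  set w : ℝ → ℝ := fun t => ∫ x, ‖ω t x‖ ^ 2 ∂m
  set g : ℝ → ℝ := fun t => ∫ x, ⟪ω t x, ω' t x⟫ ∂m
  set B : ℝ → ℝ := fun t => ∫ x, ‖ω' t x‖ ^ 2 ∂m with hBdef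
  have hw : ∀ t ∈ I, 0 < w t := fun t ht =>
    lt_of_le_of_ne (integral_nonneg fun x => by positivity) (hϖne t ht.1 ht.2).symm
  have hinner : ∀ t ∈ I, Integrable (fun x => ⟪ω t x, ω' t x⟫) m := fun t ht =>
    integrable_inner_of_sq (hmeas t ht.1 ht.2).1 (hmeas t ht.1 ht.2).2
      (hω2 t ht.1 ht.2) (hω'2 t ht.1 ht.2)
  have hCS : ∀ t ∈ I, g t ^ 2 ≤ w t * B t := fun t ht =>
    sq_integral_inner_le (hω2 t ht.1 ht.2) (hω'2 t ht.1 ht.2) (hinner t ht)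
  have hlow : ∀ t ∈ I, ∀ᵐ x ∂m,
      (4 + c) * ‖ω' t x‖ ^ 2 ≤ ‖ω' t x‖ ^ 2 + ⟪ω t x, ω'' t x⟫ := by
    intro t ht
    filter_upwards [halign t ht.1 ht.2] with x ⟨h1, h2, h3⟩
    rw [h1, inner_smul_right, real_inner_self_eq_norm_sq]
    have h4 : ‖ω' t x‖ ^ 2 ≤ μm t x ^ 2 * ‖ω t x‖ ^ 2 := by
      rw [← mul_pow]; exact pow_le_pow_left₀ (norm_nonneg _) h2 2
    have h5 := mul_le_mul_of_nonneg_right h3 (sq_nonneg ‖ω t x‖)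
    have h6 := mul_le_mul_of_nonneg_left h4 (by linarith : (0 : ℝ) ≤ 3 + c)
    linarith
  have hkint : ∀ t ∈ I, Integrable (fun x => ‖ω' t x‖ ^ 2 + ⟪ω t x, ω'' t x⟫) m := by
    intro t ht
    obtain ⟨b, htb, hbT⟩ := EReal.lt_iff_exists_real_btwn.1 ht.2
    rw [EReal.coe_lt_coe_iff] at htb
    have hsub : Set.Icc t b ⊆ I := fun s hs =>
      ⟨ht.1.trans hs.1, (EReal.coe_le_coe_iff.2 hs.2).trans_lt hbT⟩
    refine integrable_deriv_of_differentiableWithinAt_integral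
      (h := fun s x => ⟪ω s x, ω' s x⟫)
      (h' := fun s x => ‖ω' s x‖ ^ 2 + ⟪ω s x, ω'' s x⟫) htb
      (fun s hs => hinner s (hsub hs)) ?_ ?_
      ((hgderiv t ht.1 ht.2).differentiableWithinAt.mono hsub)
    · filter_upwards [hderiv] with x hx s hs
      have hs' := hsub hs
      obtain ⟨h1, h2⟩ := hx s hs'.1 hs'.2
      refine ((h1.inner ℝ h2).mono hsub).congr_deriv ?_
      rw [real_inner_self_eq_norm_sq, add_comm]
    · intro s hs
      filter_upwards [hlow s (hsub hs)] with x hx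
      exact le_trans (by positivity) hx
  have hBg : ∀ t ∈ I, (4 + c) * B t ≤ ∫ x, (‖ω' t x‖ ^ 2 + ⟪ω t x, ω'' t x⟫) ∂m := by
    intro t ht
    rw [hBdef, ← integral_const_mul]
    exact integral_mono_ae ((hω'2 t ht.1 ht.2).const_mul _) (hkint t ht) (hlow t ht)
  have hw0 := hw t₀ ht₀
  have hg0 : g t₀ = v₀ * w t₀ ^ 2 := by
    rw [← hv0]; exact (div_mul_cancel₀ _ (by positivity)).symm
  have hgpos : 0 < g t₀ := by rw [hg0]; positivity
  have main : ∀ t ∈ I, 0 < g t ∧ w t₀ ≤ w t ∧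
      w t ^ 2 / g t ≤ w t₀ ^ 2 / g t₀ - c * w t₀ * (t - t₀) := sq_div_le_of_hasDerivWithinAt hI hc ht₀ (fun t ht => ht.1) hw
    (fun t ht => hϖderiv t ht.1 ht.2) (fun t ht => hgderiv t ht.1 ht.2)
    (fun t ht => by
      have h1 := mul_le_mul_of_nonneg_left (hCS t ht) (by linarith : (0 : ℝ) ≤ 4 + c)
      have h2 := mul_le_mul_of_nonneg_left (hBg t ht) (hw t ht).le
      linarith) hgpos
  change (∀ t : ℝ, t₀ ≤ t → (t : EReal) < T → t < t₀ + 1 / (c * w t₀ * v₀) →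
      √(B t) ≥ √(w t₀) / c / (t₀ + 1 / (c * w t₀ * v₀) - t)) ∧
    T ≤ ((t₀ + 1 / (c * w t₀ * v₀) : ℝ) : EReal) ∧
    (T = ((t₀ + 1 / (c * w t₀ * v₀) : ℝ) : EReal) → ∀ M : ℝ,
      ∃ᶠ t in nhdsWithin (t₀ + 1 / (c * w t₀ * v₀)) (Set.Iio (t₀ + 1 / (c * w t₀ * v₀))),
        M ≤ √(B t))
  set T₀ := t₀ + 1 / (c * w t₀ * v₀) with hT₀
  have main' : ∀ t ∈ I, w t ^ 2 ≤ c * w t₀ * (T₀ - t) * g t := by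
    intro t ht
    obtain ⟨h1, -, h3⟩ := main t ht
    rw [div_le_iff₀ h1, hg0] at h3
    refine h3.trans_eq ?_
    rw [hT₀]
    field_simp
    ring
  have hlt : ∀ t ∈ I, t < T₀ := by
    intro t ht
    have h1 := (pow_pos (hw t ht) 2).trans_le (main' t ht)
    have h2 := pos_of_mul_pos_left h1 (main t ht).1.le
    have h3 := pos_of_mul_pos_right h2 (mul_pos hc hw0).le
    linarith
  have hbound : ∀ t ∈ I, √(w t₀) / c / (T₀ - t) ≤ √(B t) := by
    intro t ht
    obtain ⟨h1, h2, -⟩ := main t ht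
    have hd : 0 < T₀ - t := sub_pos.2 (hlt t ht)
    have hwt := hw t ht
    refine Real.le_sqrt_of_sq_le ?_
    rw [div_pow, div_pow, Real.sq_sqrt hw0.le, div_div, div_le_iff₀ (by positivity)]
    have h4 := main' t ht
    have h5 : (w t ^ 2) ^ 2 ≤ (c * w t₀ * (T₀ - t)) ^ 2 * (w t * B t) := by
      refine (pow_le_pow_left₀ (by positivity) h4 2).trans ?_
      rw [mul_pow]
      exact mul_le_mul_of_nonneg_left (hCS t ht) (by positivity)
    have h6 : w t ^ 3 ≤ w t₀ ^ 2 * (B t * (c ^ 2 * (T₀ - t) ^ 2)) := by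
      refine le_of_mul_le_mul_left ?_ hwt
      linarith
    have h7 : w t₀ ^ 3 ≤ w t ^ 3 := pow_le_pow_left₀ hw0.le h2 3
    refine le_of_mul_le_mul_left ?_ (pow_pos hw0 2)
    linarith
  refine ⟨fun t h1 h2 _ => hbound t ⟨h1, h2⟩, ?_, ?_⟩
  · by_contra! hcon
    have hTt : t₀ ≤ T₀ := (hlt t₀ ht₀).le
    exact lt_irrefl _ (hlt T₀ ⟨hTt, hcon⟩)
  · intro hTT M
    have hlim : Filter.Tendsto (fun t => √(w t₀) / c / (T₀ - t)) (nhdsWithin T₀ (Set.Iio T₀))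
        Filter.atTop := by
      simp only [div_eq_mul_inv (√(w t₀) / c)]
      refine Filter.Tendsto.const_mul_atTop (div_pos (Real.sqrt_pos.2 hw0) hc) ?_
      refine tendsto_inv_nhdsGT_zero.comp (tendsto_nhdsWithin_iff.2 ⟨?_, ?_⟩)
      · have : Continuous fun t => T₀ - t := by fun_prop
        simpa using (this.tendsto T₀).mono_left nhdsWithin_le_nhds
      · filter_upwards [self_mem_nhdsWithin] with t ht using sub_pos.2 (Set.mem_Iio.1 ht)
    refine Filter.Eventually.frequently ?_
    filter_upwards [hlim.eventually_ge_atTop M, self_mem_nhdsWithin,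
      mem_nhdsWithin_of_mem_nhds (Ioi_mem_nhds (hlt t₀ ht₀))] with t h1 h2 h3
    exact h1.trans (hbound t ⟨le_of_lt h3, by rw [hTT]; exact EReal.coe_lt_coe_iff.2 h2⟩)
end
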